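/- arXiv:2011.06972 — 2 statements merged into one kernel-verified Lean document; each statement's English description precedes it below -/
import Mathlib

section
/- Let S : [0,∞) → ℝ be non-decreasing with G(s) = ∫₀^∞ S(e^u) e^{−su} du converging for Re s > 1, let L > 0, I = [−L/2, L/2], and for n ∈ ℤ let e_n(t) = L^{−1/2} e^{2πint/L} on I. Then for every ε > 0 and every n ∈ ℤ, (1/π) ∫_I ∫_I e_n(τ) · Re G(1+ε+i(t−τ)) · conj(e_n(t)) dτ dt = (1/2π) ∫_ℝ (S(e^{|u|})/e^{|u|}) · L · ( sin(uL/2) / (uL/2 − πn) )² · e^{−ε|u|} du. -/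
open MeasureTheory Set Filter

lemma fub (V : ℝ → ℂ) (hV : Integrable V) (g : ℝ → ℂ) (hg : Continuous g) (a b σ : ℝ) :
    Integrable (fun u => V u * ∫ t in Icc a b, g t * Complex.exp (Complex.I * (σ * t * u))) ∧
    ∫ t in Icc a b, g t * (∫ u, V u * Complex.exp (Complex.I * (σ * t * u)))
      = ∫ u, V u * ∫ t in Icc a b, g t * Complex.exp (Complex.I * (σ * t * u)) := by
  have hgi : Integrable g (volume.restrict (Icc a b)) := hg.integrableOn_Icc
  have hp : Integrable (fun p : ℝ × ℝ => (g p.1 * V p.2) * Complex.exp (Complex.I * (σ * p.1 * p.2)))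
      ((volume.restrict (Icc a b)).prod volume) := by
    refine (hgi.mul_prod hV).mul_bdd (c := 1) ?_ ?_
    · exact Continuous.aestronglyMeasurable (by fun_prop)
    · refine Eventually.of_forall fun p => ?_
      have : Complex.I * (σ * p.1 * p.2) = ((σ * p.1 * p.2 : ℝ) : ℂ) * Complex.I := by
        push_cast; ring
      rw [this, Complex.norm_exp_ofReal_mul_I]
  constructor
  · refine hp.integral_prod_right.congr (Eventually.of_forall fun u => ?_)
    simp only
    rw [← integral_const_mul]
    congr 1; ext t; ring
  · have := integral_integral_swap (f := fun t u => (g t * V u) * Complex.exp (Complex.I * (σ * t * u))) hp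
    simp only [← integral_const_mul]
    calc _ = _ := by
          congr 1; ext t; congr 1; ext u; ring
      _ = _ := this
      _ = _ := by
          congr 1; ext u; congr 1; ext t; ring

lemma coefA (L : ℝ) (hL : 0 < L) (n : ℤ) (u : ℝ) (hu : u * L / 2 - Real.pi * n ≠ 0) :
    (∫ t in Icc (-(L/2)) (L/2), (((Real.sqrt L)⁻¹ : ℂ) *
        Complex.exp (2 * Real.pi * Complex.I * n * t / L)) *
        Complex.exp (Complex.I * ((-1 : ℝ) * t * u)))
      = ((Real.sqrt L * (Real.sin (n * Real.pi - u * L / 2) / (n * Real.pi - u * L / 2)) : ℝ) : ℂ) := by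
  set θ : ℝ := n * Real.pi - u * L / 2 with hθ
  have hθ0 : θ ≠ 0 := by intro h; apply hu; linarith
  have hθc : (θ : ℂ) ≠ 0 := by exact_mod_cast hθ0
  have hLc : (L : ℂ) ≠ 0 := by exact_mod_cast hL.ne'
  have hs : (Real.sqrt L : ℂ) ≠ 0 := by exact_mod_cast (Real.sqrt_pos.2 hL).ne'
  have hs2 : (Real.sqrt L : ℂ) ^ 2 = L := by exact_mod_cast Real.sq_sqrt hL.le
  set c : ℂ := 2 * θ / L * Complex.I with hc
  have hc0 : c ≠ 0 := by simp [hc, hθ0, hL.ne']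
  have h1 : ∀ t : ℝ, (((Real.sqrt L)⁻¹ : ℂ) *
        Complex.exp (2 * Real.pi * Complex.I * n * t / L)) *
        Complex.exp (Complex.I * ((-1 : ℝ) * t * u)) = ((Real.sqrt L)⁻¹ : ℂ) * Complex.exp (c * t) := by
    intro t
    rw [mul_assoc, ← Complex.exp_add]
    congr 2
    rw [hc, hθ]; push_cast; field_simp; ring
  simp only [h1]
  rw [integral_const_mul, integral_Icc_eq_integral_Ioc, ← intervalIntegral.integral_of_le (by linarith),
    integral_exp_mul_complex hc0]
  have h2 : c * ((L/2 : ℝ) : ℂ) = θ * Complex.I := by rw [hc]; push_cast; field_simp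
  have h3 : c * ((-(L/2) : ℝ) : ℂ) = -θ * Complex.I := by rw [hc]; push_cast; field_simp
  rw [h2, h3]
  push_cast
  rw [Complex.sin, hc]
  field_simp
  rw [hs2, Complex.I_sq]; ring

lemma reG (w : ℝ → ℝ) (hw : IntegrableOn w (Ioi 0)) (x : ℝ) :
    Integrable (fun u => (w |u| : ℂ)) ∧
    (((∫ u in Ioi (0:ℝ), (w u : ℂ) * Complex.exp (-(Complex.I * x * u))).re : ℝ) : ℂ)
      = (1/2) * ∫ u, (w |u| : ℂ) * Complex.exp (Complex.I * (x * u)) := by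
  have hwc : IntegrableOn (fun u => (w |u| : ℂ)) (Ioi 0) := by
    refine IntegrableOn.congr_fun (f := fun u => (w u : ℂ)) hw.ofReal ?_ measurableSet_Ioi
    intro u hu; simp [abs_of_pos (mem_Ioi.1 hu)]
  have hwi : Integrable (fun u => (w |u| : ℂ)) := by
    rw [← integrableOn_univ, ← Iic_union_Ioi (a := (0:ℝ))]
    refine IntegrableOn.union ?_ hwc
    rw [← neg_zero, ← integrableOn_Ici_iff_integrableOn_Ioi] at *
    have := hwc.comp_neg
    simpa using this
  refine ⟨hwi, ?_⟩
  have hb : ∀ y : ℝ, Integrable (fun u : ℝ => (w |u| : ℂ) * Complex.exp (Complex.I * (y * u))) := by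
    intro y
    refine hwi.mul_bdd (c := 1) (Continuous.aestronglyMeasurable (by fun_prop)) ?_
    refine Eventually.of_forall fun p => ?_
    have : Complex.I * (y * p) = ((y * p : ℝ) : ℂ) * Complex.I := by
      push_cast; ring
    rw [this, Complex.norm_exp_ofReal_mul_I]
  rw [← integral_add_compl measurableSet_Ioi (hb x), compl_Ioi, Complex.re_eq_add_conj, ← integral_conj]
  have e1 : ∫ u in Iic (0:ℝ), (w |u| : ℂ) * Complex.exp (Complex.I * (x * u)) =
     ∫ u in Ioi (0:ℝ), (w u : ℂ) * Complex.exp (-(Complex.I * x * u)) := by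
    rw [← neg_zero, ← integral_comp_neg_Ioi, neg_zero]
    refine setIntegral_congr_fun measurableSet_Ioi fun u hu => ?_
    simp only [abs_neg, abs_of_pos (mem_Ioi.1 hu)]
    push_cast; congr 2; ring
  have e2 : ∫ u in Ioi (0:ℝ), (w |u| : ℂ) * Complex.exp (Complex.I * (x * u)) =
     ∫ u in Ioi (0:ℝ), (starRingEnd ℂ) ((w u : ℂ) * Complex.exp (-(Complex.I * x * u))) := by
    refine setIntegral_congr_fun measurableSet_Ioi fun u hu => ?_
    simp only [abs_of_pos (mem_Ioi.1 hu), map_mul, ← Complex.exp_conj, map_neg, Complex.conj_ofReal, Complex.conj_I]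
    congr 2; ring
  rw [e1, e2]; ring

/-- Let `S : [0,∞) → ℝ` be non-decreasing with `G(s) = ∫₀^∞ S(e^u) e^{−su} du` converging
for `Re s > 1`, let `I = [−L/2, L/2]`, and let `e_n(t) = L^{−1/2} e^{2πint/L}` be the
standard orthonormal exponential basis of `L²(I)`.  Then for every `ε > 0` and `n ∈ ℤ`,
`(1/π) ∫_I ∫_I e_n(τ)·Re G(1+ε+i(t−τ))·conj(e_n(t)) dτ dt
   = (1/2π) ∫_ℝ (S(e^{|u|})/e^{|u|})·L·(sin(uL/2)/(uL/2 − πn))²·e^{−ε|u|} du`. -/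
theorem matrix_coefficient_formula
    (S : ℝ → ℝ) (hmono : MonotoneOn S (Ici (0 : ℝ)))
    (hconv : ∀ s : ℂ, 1 < s.re →
      IntegrableOn (fun u : ℝ => (S (Real.exp u) : ℂ) * Complex.exp (-s * u)) (Ioi 0))
    (G : ℂ → ℂ)
    (hG : ∀ s : ℂ, 1 < s.re →
      G s = ∫ u in Ioi (0 : ℝ), (S (Real.exp u) : ℂ) * Complex.exp (-s * u))
    (L : ℝ) (hL : 0 < L)
    (e : ℤ → ℝ → ℂ)
    (he : ∀ n : ℤ, ∀ t : ℝ,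
      e n t = ((Real.sqrt L)⁻¹ : ℂ) *
        Complex.exp (2 * Real.pi * Complex.I * n * t / L))
    (ε : ℝ) (hε : 0 < ε) (n : ℤ) :
    (1 / (Real.pi : ℂ)) *
        ∫ t in Icc (-(L / 2)) (L / 2),
          (∫ τ in Icc (-(L / 2)) (L / 2),
            e n τ * ((G (1 + ε + Complex.I * (t - τ))).re : ℂ))
          * (starRingEnd ℂ) (e n t)
      = (((1 / (2 * Real.pi)) *
          ∫ u : ℝ, (S (Real.exp |u|) / Real.exp |u|) * L *
            (Real.sin (u * L / 2) / (u * L / 2 - Real.pi * n)) ^ 2 *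
            Real.exp (-ε * |u|) : ℝ) : ℂ) := by
  have hcont : ∀ n, Continuous (e n) := by
    intro n
    rw [show e n = _ from funext (he n)]
    fun_prop
  set w : ℝ → ℝ := fun u => S (Real.exp u) / Real.exp u * Real.exp (-ε * u) with hwdef
  have hwexp : ∀ u x : ℝ, (S (Real.exp u) : ℂ) * Complex.exp (-(1 + ε + Complex.I * x) * u)
      = (w u : ℂ) * Complex.exp (-(Complex.I * x * u)) := by
    intro u x
    have h1 : -(1 + (ε:ℂ) + Complex.I * x) * u = -(u : ℂ) + (-ε * u) + -(Complex.I * x * u) := by ring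
    rw [h1, Complex.exp_add, Complex.exp_add, Complex.exp_neg (u : ℂ), hwdef]
    push_cast
    ring
  have hre : ∀ x : ℝ, 1 < (1 + (ε:ℂ) + Complex.I * x).re := by
    intro x; simp [hε]
  have hw : IntegrableOn w (Ioi 0) := by
    have h := hconv _ (hre 0)
    simp only [hwexp] at h
    have h2 := h.re
    simpa [IntegrableOn] using h2
  have hGre : ∀ x : ℝ, ((G (1 + ε + Complex.I * x)).re : ℂ)
      = (1/2) * ∫ u, (w |u| : ℂ) * Complex.exp (Complex.I * (x * u)) := by
    intro x
    rw [hG _ (hre x)]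
    simp only [hwexp]
    exact (reG w hw x).2
  have hwi := (reG w hw 0).1
  set A : ℝ → ℂ := fun u => ∫ t in Icc (-(L / 2)) (L / 2),
    e n t * Complex.exp (Complex.I * ((-1 : ℝ) * t * u)) with hA
  have hinner : ∀ t : ℝ, ∫ τ in Icc (-(L / 2)) (L / 2),
      e n τ * ((G (1 + ε + Complex.I * (t - τ))).re : ℂ)
      = (1/2) * ∫ u, ((w |u| : ℂ) * A u) * Complex.exp (Complex.I * ((1 : ℝ) * t * u)) := by
    intro t
    have hV : Integrable (fun u : ℝ => (w |u| : ℂ) * Complex.exp (Complex.I * (t * u))) := by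
      refine hwi.mul_bdd (c := 1) (Continuous.aestronglyMeasurable (by fun_prop)) ?_
      refine Eventually.of_forall fun p => ?_
      have : Complex.I * (t * p) = ((t * p : ℝ) : ℂ) * Complex.I := by
        push_cast; ring
      rw [this, Complex.norm_exp_ofReal_mul_I]
    have h := (fub _ hV (e n) (hcont n) (-(L/2)) (L/2) (-1)).2
    calc _ = ∫ τ in Icc (-(L / 2)) (L / 2), (1/2 : ℂ) * (e n τ * ∫ u : ℝ,
          (w |u| : ℂ) * Complex.exp (Complex.I * (t * u)) *
            Complex.exp (Complex.I * ((-1 : ℝ) * τ * u))) := by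
          congr 1; ext τ
          have h1 := hGre (t - τ)
          push_cast at h1
          rw [h1]
          have h2 : ∀ u : ℝ, (w |u| : ℂ) * Complex.exp (Complex.I * ((t - τ) * u)) =
              (w |u| : ℂ) * Complex.exp (Complex.I * (t * u)) *
            Complex.exp (Complex.I * ((-1 : ℝ) * τ * u)) := by
            intro u
            rw [mul_assoc, ← Complex.exp_add]
            congr 2; push_cast; ring
          simp only [h2]
          ring
      _ = _ := by
          rw [integral_const_mul, h]
          congr 2; ext u
          simp only [hA, Complex.ofReal_one, one_mul]
          ring
  have hVA := (fub _ hwi (e n) (hcont n) (-(L/2)) (L/2) (-1)).1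
  have houter := (fub _ hVA (fun t => (starRingEnd ℂ) (e n t))
    (Complex.continuous_conj.comp (hcont n)) (-(L/2)) (L/2) 1).2
  have hB : ∀ u : ℝ, ∫ t in Icc (-(L / 2)) (L / 2),
      (starRingEnd ℂ) (e n t) * Complex.exp (Complex.I * ((1 : ℝ) * t * u)) = (starRingEnd ℂ) (A u) := by
    intro u
    rw [hA]
    simp only
    rw [← integral_conj]
    congr 1; ext t
    rw [map_mul, ← Complex.exp_conj]
    simp
  have hLHS : ∫ t in Icc (-(L / 2)) (L / 2),
          (∫ τ in Icc (-(L / 2)) (L / 2),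
            e n τ * ((G (1 + ε + Complex.I * (t - τ))).re : ℂ))
          * (starRingEnd ℂ) (e n t) = (1/2) * ∫ u : ℝ, (w |u| : ℂ) * A u * (starRingEnd ℂ) (A u) := by
    simp only [hB] at houter
    rw [← houter, ← integral_const_mul]
    congr 1; ext t
    rw [hinner t]; ring
  have hae : ∀ᵐ u : ℝ, (w |u| : ℂ) * A u * (starRingEnd ℂ) (A u) =
      (((S (Real.exp |u|) / Real.exp |u|) * L *
            (Real.sin (u * L / 2) / (u * L / 2 - Real.pi * n)) ^ 2 *
            Real.exp (-ε * |u|) : ℝ) : ℂ) := by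
    have h0 : ∀ᵐ u : ℝ, u ≠ 2 * Real.pi * n / L := by
      simp [ae_iff]
    filter_upwards [h0] with u hu
    have hu' : u * L / 2 - Real.pi * n ≠ 0 := by
      intro h; apply hu; field_simp; linarith
    have hAu : A u = ((Real.sqrt L * (Real.sin (n * Real.pi - u * L / 2) /
        (n * Real.pi - u * L / 2)) : ℝ) : ℂ) := by
      rw [hA]; simp only [he]; exact coefA L hL n u hu'
    rw [hAu, Complex.conj_ofReal]
    norm_cast
    rw [Real.sin_int_mul_pi_sub, hwdef]
    have hsq : (((-1 : ℝ) ^ n)) ^ 2 = 1 := by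
      rw [← zpow_natCast, ← zpow_mul, mul_comm, zpow_mul]; simp
    have hsL := Real.sq_sqrt hL.le
    have hd : (n * Real.pi - u * L / 2) = -(u * L / 2 - Real.pi * n) := by ring
    rw [hd]
    simp only [neg_div_neg_eq]
    calc _ = S (Real.exp |u|) / Real.exp |u| * Real.exp (-ε * |u|) * (Real.sqrt L ^ 2) *
        ((-1 : ℝ) ^ n) ^ 2 * (Real.sin (u * L / 2) / (u * L / 2 - Real.pi * n)) ^ 2 := by ring
      _ = _ := by rw [hsq, hsL]; ring
  rw [hLHS, integral_congr_ae hae, integral_complex_ofReal]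
  push_cast
  ring
end

section
/- Let S : [0,∞) → ℝ be non-decreasing, let A ∈ ℝ, and suppose the function h(u) = S(e^{|u|})/e^{|u|} − A is bounded on ℝ. Suppose there exists L₀ > 0 such that for every L ≥ L₀, lim_{n→∞} (1/2π) ∫_ℝ h(u) · L · ( sin(uL/2) / (uL/2 − πn) )² du = 0. Then h(u) → 0 as u → ∞; equivalently, lim_{u→∞} S(e^u)/e^u = A. -/
open MeasureTheory Set Filter

lemma fejer_kernel_integrable : Integrable (fun t : ℝ => (Real.sin t / t) ^ 2) := by
  have h2 : Integrable (fun t : ℝ => 2 * (1 + t ^ 2)⁻¹) := integrable_inv_one_add_sq.const_mul 2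
  refine h2.mono' ((Real.measurable_sin.div measurable_id).pow_const 2).aestronglyMeasurable (ae_of_all _ fun t => ?_)
  rw [Real.norm_eq_abs, abs_of_nonneg (sq_nonneg _)]
  by_cases ht : t = 0
  · subst ht; simp
  have ht2 : 0 < t ^ 2 := by positivity
  have h1 : Real.sin t ^ 2 ≤ 1 := Real.sin_sq_le_one t
  have h3 : Real.sin t ^ 2 ≤ t ^ 2 := sq_le_sq.mpr Real.abs_sin_le_abs
  rw [div_pow, ← div_eq_mul_inv, div_le_div_iff₀ ht2 (by positivity)]
  nlinarith

lemma fejer_kernel_pos : 0 < ∫ t : ℝ, (Real.sin t / t) ^ 2 := by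
  rw [integral_pos_iff_support_of_nonneg (fun t => sq_nonneg _) fejer_kernel_integrable]
  refine lt_of_lt_of_le ?_ (measure_mono (s := Ioo (0 : ℝ) 1) ?_)
  · simp
  · intro t ht
    have h1 := Real.sin_pos_of_pos_of_lt_pi ht.1 (by linarith [ht.2, Real.pi_gt_three])
    have h0 := ht.1
    simp only [Function.mem_support]
    positivity

lemma fejer_change_var (h : ℝ → ℝ) (L : ℝ) (hL : 0 < L) (n : ℕ) :
    ∫ u : ℝ, h u * L * (Real.sin (u * L / 2) / (u * L / 2 - Real.pi * n)) ^ 2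
      = 2 * ∫ t : ℝ, h ((2 / L) * (t + Real.pi * n)) * (Real.sin t / t) ^ 2 := by
  have hs : ∀ u : ℝ, Real.sin (u * L / 2) ^ 2 = Real.sin (u * L / 2 - Real.pi * n) ^ 2 := by
    intro u
    rw [mul_comm Real.pi, Real.sin_sub_nat_mul_pi, mul_pow, ← pow_mul, mul_comm n 2, pow_mul]
    simp
  set G : ℝ → ℝ := fun t => h ((2 / L) * (t + Real.pi * n)) * (Real.sin t / t) ^ 2 with hG
  have e : (fun u : ℝ => h u * L * (Real.sin (u * L / 2) / (u * L / 2 - Real.pi * n)) ^ 2)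
      = fun u => L * G (u * (L / 2) - Real.pi * n) := by
    funext u
    simp only [hG]
    have e1 : (2 / L) * (u * (L / 2) - Real.pi * n + Real.pi * n) = u := by field_simp; ring
    rw [e1, div_pow, div_pow, hs, mul_div_assoc]
    ring
  rw [e, integral_const_mul,
    Measure.integral_comp_mul_right (fun x => G (x - Real.pi * n)) (L / 2),
    integral_sub_right_eq_self G]
  rw [abs_of_pos (by positivity), smul_eq_mul]
  field_simp

lemma fejer_core (h : ℝ → ℝ) (hm : Measurable h) (C : ℝ) (hC : ∀ u, |h u| ≤ C) (L₀ : ℝ)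
    (hlim : ∀ L : ℝ, 0 < L → L₀ ≤ L → Tendsto
      (fun n : ℕ => ∫ t : ℝ, h ((2 / L) * (t + Real.pi * n)) * (Real.sin t / t) ^ 2)
      atTop (nhds 0)) (ε δ : ℝ) (hε : 0 < ε) (hδ : 0 < δ) :
    ∀ᶠ u₀ : ℝ in atTop, ¬ ∀ v ∈ Icc u₀ (u₀ + δ), ε ≤ h v := by
  set K : ℝ → ℝ := fun t => (Real.sin t / t) ^ 2 with hK
  have hKi : Integrable K := fejer_kernel_integrable
  have hI : 0 < ∫ t, K t := fejer_kernel_pos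
  have hK0 : ∀ t, 0 ≤ K t := fun t => sq_nonneg _
  -- choice of T
  have ht : Tendsto (fun T : ℝ => (ε + C) * (∫ t in (-T)..T, K t) - C * ∫ t, K t) atTop
      (nhds ((ε + C) * (∫ t, K t) - C * ∫ t, K t)) :=
    ((intervalIntegral_tendsto_integral hKi tendsto_neg_atTop_atBot tendsto_id).const_mul _).sub_const _
  have hpos : 0 < (ε + C) * (∫ t, K t) - C * ∫ t, K t := by nlinarith
  obtain ⟨T, hTpos, hT0⟩ := ((ht.eventually (lt_mem_nhds hpos)).and (eventually_ge_atTop 0)).exists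
  rw [intervalIntegral.integral_of_le (by linarith), ← integral_indicator measurableSet_Ioc] at hTpos
  set c := (ε + C) * (∫ t, (Ioc (-T) T).indicator K t) - C * ∫ t, K t with hc
  -- choice of L
  set L : ℝ := max (max L₀ 1) (2 * (2 * T + Real.pi) / δ) with hLdef
  have hLL : L₀ ≤ L := (le_max_left _ _).trans (le_max_left _ _)
  have hL0 : 0 < L := lt_of_lt_of_le one_pos ((le_max_right _ _).trans (le_max_left _ _))
  have hLδ : 2 * (2 * T + Real.pi) ≤ L * δ := by
    have := le_max_right (max L₀ 1) (2 * (2 * T + Real.pi) / δ)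
    rwa [← hLdef, div_le_iff₀ hδ] at this
  have hev := (hlim L hL0 hLL).eventually (gt_mem_nhds hTpos)
  obtain ⟨N, hN⟩ := eventually_atTop.1 hev
  have hπ := Real.pi_pos
  filter_upwards [eventually_ge_atTop (2 * Real.pi * N / L), eventually_ge_atTop 0] with u₀ hu hu0 hall
  set n : ℕ := ⌈(L * u₀ / 2 + T) / Real.pi⌉₊ with hn
  have hn1 : L * u₀ / 2 + T ≤ Real.pi * n := by
    have := Nat.le_ceil ((L * u₀ / 2 + T) / Real.pi)
    rw [div_le_iff₀ hπ] at this
    linarith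
  have hn2 : Real.pi * n ≤ L * u₀ / 2 + T + Real.pi := by
    have := (Nat.ceil_lt_add_one (a := (L * u₀ / 2 + T) / Real.pi) (by positivity)).le
    have h2 := mul_le_mul_of_nonneg_left this hπ.le
    rw [mul_add, mul_div_cancel₀ _ hπ.ne'] at h2
    linarith
  have hNn : N ≤ n := by
    rw [div_le_iff₀ hL0] at hu
    have : Real.pi * N ≤ Real.pi * n := by linarith
    exact_mod_cast le_of_mul_le_mul_left this hπ
  have hlt := hN n hNn
  refine absurd hlt (not_lt.mpr ?_)
  rw [hc, ← integral_const_mul, ← integral_const_mul, ← integral_sub]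
  · refine integral_mono ?_ ?_ ?_
    · exact ((hKi.indicator measurableSet_Ioc).const_mul _).sub (hKi.const_mul _)
    · refine hKi.bdd_mul (c := C) (hm.comp (by fun_prop)).aestronglyMeasurable (ae_of_all _ fun t => ?_)
      exact hC _
    · intro t
      have hk := hK0 t
      by_cases htT : t ∈ Ioc (-T) T
      · simp only [indicator_of_mem htT]
        have hv : ε ≤ h ((2 / L) * (t + Real.pi * n)) := by
          apply hall
          have e : (2 / L) * (t + Real.pi * n) = (2 * (t + Real.pi * n)) / L := by ring
          rw [e]
          constructor
          · rw [le_div_iff₀ hL0]; nlinarith [htT.1]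
          · rw [div_le_iff₀ hL0]; nlinarith [htT.2]
        nlinarith [mul_le_mul_of_nonneg_right hv hk]
      · simp only [indicator_of_notMem htT]
        have := mul_le_mul_of_nonneg_right (neg_le_of_abs_le (hC ((2 / L) * (t + Real.pi * n)))) hk
        simp only [hK] at this ⊢
        linarith
  · exact (hKi.indicator measurableSet_Ioc).const_mul _
  · exact hKi.const_mul _

/-- Let `S : [0,∞) → ℝ` be non-decreasing, `A ∈ ℝ`, and suppose
`h(u) = S(e^{|u|})/e^{|u|} − A` is bounded on `ℝ`.  If there exists `L₀ > 0` such that for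
every `L ≥ L₀` the Fejér-type integrals
`(1/2π) ∫_ℝ h(u)·L·(sin(uL/2)/(uL/2 − πn))² du` tend to `0` as `n → ∞`, then `h(u) → 0`
as `u → ∞`; equivalently, `S(e^u)/e^u → A`. -/
theorem tendsto_of_fejer_coefficients_tendsto_zero
    (S : ℝ → ℝ) (hmono : MonotoneOn S (Ici (0 : ℝ))) (A : ℝ)
    (h : ℝ → ℝ)
    (hh : ∀ u : ℝ, h u = S (Real.exp |u|) / Real.exp |u| - A)
    (hbdd : ∃ C : ℝ, ∀ u : ℝ, |h u| ≤ C)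
    (hfejer : ∃ L₀ : ℝ, 0 < L₀ ∧ ∀ L : ℝ, L₀ ≤ L →
      Tendsto
        (fun n : ℕ => (1 / (2 * Real.pi)) *
          ∫ u : ℝ, h u * L * (Real.sin (u * L / 2) / (u * L / 2 - Real.pi * n)) ^ 2)
        atTop (nhds 0)) :
    Tendsto h atTop (nhds 0) ∧
    Tendsto (fun u : ℝ => S (Real.exp u) / Real.exp u) atTop (nhds A) := by
  obtain ⟨C, hC⟩ := hbdd
  obtain ⟨L₀, hL₀, hlim⟩ := hfejer
  have hπ := Real.pi_pos
  have hm : Measurable h := by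
    have hS : Monotone (fun x : ℝ => S (max x 0)) := fun x y hxy =>
      hmono (mem_Ici.2 (le_max_right _ _)) (mem_Ici.2 (le_max_right _ _)) (max_le_max_right 0 hxy)
    have e : h = fun u => (fun x : ℝ => S (max x 0)) (Real.exp |u|) / Real.exp |u| - A := by
      funext u
      rw [hh u]
      simp only [max_eq_left (Real.exp_pos |u|).le]
    have habs : Measurable (fun u : ℝ => Real.exp |u|) :=
      (Real.continuous_exp.comp continuous_abs).measurable
    rw [e]
    exact ((hS.measurable.comp habs).div habs).sub_const A
  have hlim1 : ∀ L : ℝ, 0 < L → L₀ ≤ L → Tendsto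
      (fun n : ℕ => ∫ t : ℝ, h ((2 / L) * (t + Real.pi * n)) * (Real.sin t / t) ^ 2)
      atTop (nhds 0) := by
    intro L hL hLL
    have h1 := (hlim L hLL).const_mul Real.pi
    rw [mul_zero] at h1
    refine h1.congr fun n => ?_
    rw [fejer_change_var h L hL n]
    field_simp
  have hlim2 : ∀ L : ℝ, 0 < L → L₀ ≤ L → Tendsto
      (fun n : ℕ => ∫ t : ℝ, (fun u => - h u) ((2 / L) * (t + Real.pi * n)) * (Real.sin t / t) ^ 2)
      atTop (nhds 0) := by
    intro L hL hLL
    have h1 := (hlim1 L hL hLL).neg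
    rw [neg_zero] at h1
    refine h1.congr fun n => ?_
    rw [← integral_neg]
    simp only [neg_mul]
  -- slow variation
  have hslow : ∀ u v : ℝ, 0 ≤ u → u ≤ v → (h u + A) * Real.exp (-(v - u)) ≤ h v + A := by
    intro u v hu huv
    have hv := hu.trans huv
    rw [hh u, hh v, abs_of_nonneg hu, abs_of_nonneg hv]
    have hs : S (Real.exp u) ≤ S (Real.exp v) :=
      hmono (Real.exp_pos _).le (Real.exp_pos _).le (Real.exp_le_exp.2 huv)
    have e : Real.exp (-(v - u)) = Real.exp u / Real.exp v := by
      rw [← Real.exp_sub]; congr 1; ring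
    rw [e, sub_add_cancel, sub_add_cancel, div_mul_div_cancel₀ (Real.exp_pos u).ne']
    gcongr
  have hmain : Tendsto h atTop (nhds 0) := by
    rw [Metric.tendsto_nhds]
    intro η hη
    set ε := η / 2 with hεd
    have hε : 0 < ε := by positivity
    set δ := ε / (2 * ε + |A|) with hδd
    have hA := abs_nonneg A
    have hδ : 0 < δ := by positivity
    have hδe : δ * (2 * ε + |A|) = ε := div_mul_cancel₀ _ (by positivity)
    have E1 := fejer_core h hm C hC L₀ hlim1 ε δ hε hδ
    have E2 := fejer_core (fun u => - h u) hm.neg C (fun u => by simpa using hC u) L₀ hlim2 ε δ hε hδ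
    have E2' := (tendsto_atTop_add_const_right atTop (-δ) tendsto_id).eventually E2
    filter_upwards [E1, E2', eventually_ge_atTop δ] with u h1 h2 hu
    rw [Real.dist_eq, sub_zero]
    have key : ∀ s : ℝ, 0 ≤ s → s ≤ δ → 1 - δ ≤ Real.exp (-s) ∧ Real.exp (-s) ≤ 1 := by
      intro s hs hsδ
      exact ⟨by linarith [Real.add_one_le_exp (-s)], Real.exp_le_one_iff.2 (by linarith)⟩
    by_contra hcon
    rw [not_lt] at hcon
    rcases le_abs.1 hcon with hc | hc
    · refine h1 fun v hv => ?_
      have hs := hslow u v (by linarith) hv.1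
      obtain ⟨k1, k2⟩ := key (v - u) (by linarith [hv.1]) (by linarith [hv.2])
      set E := Real.exp (-(v - u))
      have hE : 0 < E := Real.exp_pos _
      have a1 : 2 * ε * E ≤ h u * E := mul_le_mul_of_nonneg_right (by linarith) hE.le
      have a2 : A * (1 - E) ≤ |A| * δ :=
        mul_le_mul (le_abs_self A) (by linarith) (by linarith) hA
      nlinarith
    · refine h2 fun v hv => ?_
      simp only [id] at hv
      have hs := hslow v u (by linarith [hv.1]) (by linarith [hv.2])
      obtain ⟨k1, k2⟩ := key (u - v) (by linarith [hv.2]) (by linarith [hv.1])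
      set E := Real.exp (-(u - v))
      have hE : 0 < E := Real.exp_pos _
      have a2 : A * (1 - E) ≤ |A| * δ :=
        mul_le_mul (le_abs_self A) (by linarith) (by linarith) hA
      have a3 : h v * E ≤ -ε := by nlinarith
      by_contra hlt
      nlinarith
  refine ⟨hmain, ?_⟩
  have h1 := hmain.add_const A
  rw [zero_add] at h1
  refine h1.congr' ?_
  filter_upwards [eventually_ge_atTop 0] with u hu
  rw [hh u, abs_of_nonneg hu, sub_add_cancel]
end
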